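/- (Epi-convergence under condition (d) of Theorem 1: interior points.) Let X, X^ν ⊂ ℝⁿ be nonempty closed sets with X ⊂ X^ν for each ν and X^ν set-converging to X; let h, h^ν : ℝᵐ → ℝ ∪ {+∞} be proper, lsc, convex with h^ν epi-converging to h, and suppose h is continuous relative to dom h (i.e., z^ν ∈ dom h → z ∈ dom h implies h(z^ν) → h(z)); let F, F^ν : ℝⁿ → ℝᵐ be locally Lipschitz, assume that whenever x^ν ∈ X^ν converges to x ∈ X one has F^ν(x^ν) → F(x), and assume that for every x ∈ X with F(x) in the boundary of dom h there exist x^ν ∈ X → x with F(x^ν) in the interior of dom h. Define φ(x) = h(F(x)) if x ∈ X and +∞ otherwise, and φ^ν(x) = h^ν(F^ν(x)) if x ∈ X^ν and +∞ otherwise. Then φ^ν epi-converges to φ. -/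

import Mathlib

open Filter Topology
open scoped Classical

noncomputable section

/-- Epi-convergence of a sequence of extended-real-valued functions. -/
def EpiConverges {E : Type*} [TopologicalSpace E] (g : ℕ → E → EReal) (g0 : E → EReal) : Prop :=
  (∀ (z : ℕ → E) (z0 : E), Tendsto z atTop (𝓝 z0) →
      g0 z0 ≤ liminf (fun ν => g ν (z ν)) atTop) ∧
  (∀ z0 : E, ∃ z : ℕ → E, Tendsto z atTop (𝓝 z0) ∧
      limsup (fun ν => g ν (z ν)) atTop ≤ g0 z0)

/-- Painlevé–Kuratowski set-convergence of a sequence of sets. -/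
def SetConverges {E : Type*} [TopologicalSpace E] (C : ℕ → Set E) (C0 : Set E) : Prop :=
  (∀ (N : ℕ → ℕ) (x : ℕ → E) (x0 : E), StrictMono N → (∀ k, x k ∈ C (N k)) →
      Tendsto x atTop (𝓝 x0) → x0 ∈ C0) ∧
  (∀ x0 ∈ C0, ∃ x : ℕ → E, (∀ ν, x ν ∈ C ν) ∧ Tendsto x atTop (𝓝 x0))

/-- The epigraph of an extended-real-valued function. -/
def EpiSet {E : Type*} (g : E → EReal) : Set (E × ℝ) := {p | g p.1 ≤ (p.2 : EReal)}

theorem IsClosed.mem_of_convex_of_near_cross {m : ℕ} {S : Set (Fin m → ℝ)} (hS : IsClosed S)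
    (hconv : Convex ℝ S) {c o y : Fin m → ℝ} {p q : Fin m → Fin m → ℝ} {r δ : ℝ}
    (hδ : 2 * m * δ < r) (ho : o ∈ S) (hp : ∀ i, p i ∈ S) (hq : ∀ i, q i ∈ S)
    (hpd : ∀ i, dist (p i) (c + Pi.single i r) ≤ δ)
    (hqd : ∀ i, dist (q i) (c - Pi.single i r) ≤ δ) (hy : dist y c ≤ δ) : y ∈ S := by
  by_contra hyS
  obtain ⟨f, u, hfu, huy⟩ := geometric_hahn_banach_closed_point hconv hS hyS
  set T : ℝ := ∑ i, |f (Pi.single i 1)| with hT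
  have hsum : ∀ x, f x = ∑ i, x i * f (Pi.single i 1) := fun x => by
    conv_lhs => rw [pi_eq_sum_univ' x, map_sum]
    refine Finset.sum_congr rfl fun i _ => ?_
    rw [map_smul, smul_eq_mul]
  have hbound : ∀ x z, dist x z ≤ δ → |f x - f z| ≤ δ * T := fun x z hxz => by
    rw [← map_sub, hsum, hT, Finset.mul_sum]
    refine (Finset.abs_sum_le_sum_abs _ _).trans (Finset.sum_le_sum fun i _ => ?_)
    rw [abs_mul]
    refine mul_le_mul_of_nonneg_right ?_ (abs_nonneg _)
    exact ((norm_le_pi_norm (x - z) i).trans_eq (dist_eq_norm x z).symm).trans hxz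
  have hsingle : ∀ i, f (Pi.single i r) = r * f (Pi.single i 1) := fun i => by
    rw [← smul_eq_mul, ← map_smul, ← Pi.single_smul, smul_eq_mul, mul_one]
  have hcoord : ∀ i, r * |f (Pi.single i 1)| ≤ 2 * (δ * T) := fun i => by
    have h1 := abs_le.1 (hbound _ _ (hpd i))
    have h2 := abs_le.1 (hbound _ _ (hqd i))
    have h3 := abs_le.1 (hbound _ _ hy)
    have h4 := hfu _ (hp i)
    have h5 := hfu _ (hq i)
    rw [map_add, hsingle] at h1
    rw [map_sub, hsingle] at h2
    rcases abs_cases (f (Pi.single i 1)) with ⟨h6, -⟩ | ⟨h6, -⟩ <;> rw [h6] <;> linarith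
  have hrT : r * T ≤ 2 * m * δ * T := by
    rw [hT, Finset.mul_sum, ← hT]
    refine (Finset.sum_le_sum fun i _ => hcoord i).trans_eq ?_
    simp
    ring
  have hTpos : 0 < T := by
    refine lt_of_le_of_ne (Finset.sum_nonneg fun i _ => abs_nonneg _) fun h0 => ?_
    have hz : ∀ x, f x = 0 := fun x => by
      rw [hsum]
      refine Finset.sum_eq_zero fun i hi => ?_
      rw [abs_eq_zero.1 ((Finset.sum_eq_zero_iff_of_nonneg fun i _ => abs_nonneg _).1
        h0.symm i hi), mul_zero]
    have := hfu _ ho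
    rw [hz] at this huy
    linarith
  exact absurd (le_of_mul_le_mul_right hrT hTpos) (not_le.2 hδ)

theorem isClosed_sublevel_of_isClosed_epiSet {E : Type*} [TopologicalSpace E] {g : E → EReal}
    (hg : IsClosed (EpiSet g)) (b : ℝ) : IsClosed {z | g z ≤ b} :=
  hg.preimage (f := fun z : E => (z, b)) (by fun_prop)

theorem convex_sublevel_of_convex_epiSet {E : Type*} [AddCommGroup E] [Module ℝ E]
    {g : E → EReal} (hg : Convex ℝ (EpiSet g)) (b : ℝ) : Convex ℝ {z | g z ≤ b} := by
  intro x hx y hy s t hs ht hst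
  have := hg (x := (x, b)) hx (y := (y, b)) hy hs ht hst
  simpa [EpiSet, ← add_mul, hst] using this

theorem EpiConverges.eventually_le_of_continuousAt {m : ℕ} {g : ℕ → (Fin m → ℝ) → EReal}
    {g0 : (Fin m → ℝ) → EReal} (hg : EpiConverges g g0) (hcl : ∀ ν, IsClosed (EpiSet (g ν)))
    (hcvx : ∀ ν, Convex ℝ (EpiSet (g ν))) {c : Fin m → ℝ} (hc : ContinuousAt g0 c) {b : ℝ}
    (hb : g0 c < b) {y : ℕ → Fin m → ℝ} (hy : Tendsto y atTop (𝓝 c)) :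
    ∀ᶠ ν in atTop, g ν (y ν) ≤ b := by
  obtain ⟨r, hr, hball⟩ := Metric.nhds_basis_closedBall.mem_iff.1 (hc.eventually_lt_const hb)
  have hrec : ∀ v, dist v c ≤ r → ∃ z : ℕ → Fin m → ℝ, Tendsto z atTop (𝓝 v) ∧
      ∀ᶠ ν in atTop, g ν (z ν) ≤ b := fun v hv => by
    obtain ⟨z, hz, hlim⟩ := hg.2 v
    exact ⟨z, hz, (eventually_lt_of_limsup_lt (hlim.trans_lt (hball hv))).mono fun _ h => h.le⟩
  have hnorm : ∀ i : Fin m, ‖(Pi.single i r : Fin m → ℝ)‖ ≤ r := fun i => by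
    rw [Pi.norm_single, Real.norm_of_nonneg hr.le]
  obtain ⟨o, -, ho⟩ := hrec c (by simpa using hr.le)
  choose p hp hpb using fun i => hrec (c + Pi.single i r) (by simpa [dist_eq_norm] using hnorm i)
  choose q hq hqb using fun i => hrec (c - Pi.single i r) (by simpa [dist_eq_norm] using hnorm i)
  obtain ⟨δ, hδ, hδr⟩ : ∃ δ : ℝ, 0 < δ ∧ 2 * m * δ < r := by
    refine ⟨r / (2 * m + 1), by positivity, ?_⟩
    rw [mul_div_assoc', div_lt_iff₀ (by positivity)]
    nlinarith
  filter_upwards [ho, eventually_all.2 hpb, eventually_all.2 hqb,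
    eventually_all.2 fun i => (hp i).eventually (Metric.closedBall_mem_nhds _ hδ),
    eventually_all.2 fun i => (hq i).eventually (Metric.closedBall_mem_nhds _ hδ),
    hy.eventually (Metric.closedBall_mem_nhds _ hδ)] with ν h1 h2 h3 h4 h5 h6
  exact (isClosed_sublevel_of_isClosed_epiSet (hcl ν) b).mem_of_convex_of_near_cross
    (convex_sublevel_of_convex_epiSet (hcvx ν) b) hδr h1 h2 h3 h4 h5 h6

theorem continuousAt_of_seq_continuous_of_mem_interior {E Y : Type*} [TopologicalSpace E]
    [FirstCountableTopology E] [TopologicalSpace Y] {g : E → Y} {D : Set E}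
    (hg : ∀ (z : ℕ → E) (z0 : E), (∀ ν, z ν ∈ D) → z0 ∈ D → Tendsto z atTop (𝓝 z0) →
      Tendsto (fun ν => g (z ν)) atTop (𝓝 (g z0))) {c : E} (hc : c ∈ interior D) :
    ContinuousAt g c := by
  refine tendsto_of_seq_tendsto fun u hu => ?_
  obtain ⟨N, hN⟩ := eventually_atTop.1 (hu.eventually (mem_interior_iff_mem_nhds.1 hc))
  exact (tendsto_add_atTop_iff_nat N).1 (hg (fun k => u (k + N)) c
    (fun k => hN _ (Nat.le_add_left _ _)) (interior_subset hc)
    ((tendsto_add_atTop_iff_nat N).2 hu))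

/-- Diagonal extraction for a sequence of eventually true properties. -/
theorem exists_tendsto_atTop_eventually {P : ℕ → ℕ → Prop}
    (hP : ∀ j, ∀ᶠ ν in atTop, P j ν) :
    ∃ k : ℕ → ℕ, Tendsto k atTop atTop ∧ ∀ᶠ ν in atTop, P (k ν) ν := by
  refine ⟨fun ν => Nat.findGreatest (P · ν) ν, tendsto_atTop.2 fun j => ?_, ?_⟩
  · filter_upwards [hP j, eventually_ge_atTop j] with ν h1 h2
    exact Nat.le_findGreatest h2 h1
  · filter_upwards [hP 0] with ν h1
    exact Nat.findGreatest_spec (P := (P · ν)) (Nat.zero_le ν) h1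

/-- epi-convergence of the composite functions under condition (d):
h continuous relative to its domain, X ⊂ X^ν, and boundary points of dom h reachable
through interior points. -/
theorem composite_epi_convergence_interior_points
    (n m : ℕ)
    (X : Set (Fin n → ℝ)) (Xν : ℕ → Set (Fin n → ℝ))
    (hXne : X.Nonempty) (hXcl : IsClosed X)
    (hXνne : ∀ ν, (Xν ν).Nonempty) (hXνcl : ∀ ν, IsClosed (Xν ν))
    (hXsub : ∀ ν, X ⊆ Xν ν)
    (hXconv : SetConverges Xν X)
    (h : (Fin m → ℝ) → EReal) (hν : ℕ → (Fin m → ℝ) → EReal)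
    (hbot : ∀ z, h z ≠ ⊥) (hνbot : ∀ ν z, hν ν z ≠ ⊥)
    (hproper : ∃ z, h z ≠ ⊤) (hνproper : ∀ ν, ∃ z, hν ν z ≠ ⊤)
    (hlsc : IsClosed (EpiSet h)) (hνlsc : ∀ ν, IsClosed (EpiSet (hν ν)))
    (hcvx : Convex ℝ (EpiSet h)) (hνcvx : ∀ ν, Convex ℝ (EpiSet (hν ν)))
    (hepi : EpiConverges hν h)
    (hcontrel : ∀ (z : ℕ → Fin m → ℝ) (z0 : Fin m → ℝ),
      (∀ ν, h (z ν) ≠ ⊤) → h z0 ≠ ⊤ → Tendsto z atTop (𝓝 z0) →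
      Tendsto (fun ν => h (z ν)) atTop (𝓝 (h z0)))
    (F : (Fin n → ℝ) → (Fin m → ℝ)) (Fν : ℕ → (Fin n → ℝ) → (Fin m → ℝ))
    (hF : LocallyLipschitz F) (hFν : ∀ ν, LocallyLipschitz (Fν ν))
    (hFconv : ∀ (x : ℕ → Fin n → ℝ) (x0 : Fin n → ℝ), (∀ ν, x ν ∈ Xν ν) → x0 ∈ X →
      Tendsto x atTop (𝓝 x0) → Tendsto (fun ν => Fν ν (x ν)) atTop (𝓝 (F x0)))
    (hint : ∀ x ∈ X, h (F x) ≠ ⊤ → F x ∉ interior {w | h w ≠ ⊤} →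
      ∃ xs : ℕ → Fin n → ℝ, (∀ k, xs k ∈ X) ∧ Tendsto xs atTop (𝓝 x) ∧
        ∀ k, F (xs k) ∈ interior {w | h w ≠ ⊤}) :
    EpiConverges
      (fun ν x => if x ∈ Xν ν then hν ν (Fν ν x) else ⊤)
      (fun x => if x ∈ X then h (F x) else ⊤) := by
  have hXF : ∀ x ∈ X, Tendsto (fun ν => Fν ν x) atTop (𝓝 (F x)) := fun x hx =>
    hFconv _ x (fun ν => hXsub ν hx) hx tendsto_const_nhds
  refine ⟨fun z z0 hz => ?_, fun z0 => ?_⟩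
  · by_cases hz0 : z0 ∈ X
    · have hw : Tendsto (fun ν => if z ν ∈ Xν ν then z ν else z0) atTop (𝓝 z0) :=
        hz.if' tendsto_const_nhds
      have hwX : ∀ ν, (if z ν ∈ Xν ν then z ν else z0) ∈ Xν ν := fun ν => by
        split_ifs with hzν
        exacts [hzν, hXsub ν hz0]
      simp only [if_pos hz0]
      refine (hepi.1 _ _ (hFconv _ _ hwX hz0 hw)).trans (liminf_le_liminf (.of_forall fun ν => ?_))
      by_cases hzν : z ν ∈ Xν ν <;> simp [hzν]
    · have hev : ∀ᶠ ν in atTop, z ν ∉ Xν ν := by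
        by_contra hfreq
        obtain ⟨N, hN, hNX⟩ := extraction_of_frequently_atTop (not_eventually.1 hfreq)
        exact hz0 (hXconv.1 N (z ∘ N) z0 hN (fun k => not_not.1 (hNX k))
          (hz.comp hN.tendsto_atTop))
      refine le_liminf_of_le (by isBoundedDefault) (hev.mono fun ν hν' => ?_)
      simp [hν']
  · by_cases hz0 : z0 ∈ X ∧ h (F z0) ≠ ⊤
    swap
    · refine ⟨fun _ => z0, tendsto_const_nhds, le_of_le_of_eq le_top ?_⟩
      by_cases hX : z0 ∈ X
      · simp only [if_pos hX]
        exact (not_not.1 fun hne => hz0 ⟨hX, hne⟩).symm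
      · simp only [if_neg hX]
    obtain ⟨hX, hfin⟩ := hz0
    simp only [if_pos hX]
    obtain ⟨xs, hxsX, hxs, hxsint⟩ : ∃ xs : ℕ → Fin n → ℝ, (∀ k, xs k ∈ X) ∧
        Tendsto xs atTop (𝓝 z0) ∧ ∀ k, F (xs k) ∈ interior {w | h w ≠ ⊤} := by
      by_cases hi : F z0 ∈ interior {w | h w ≠ ⊤}
      · exact ⟨fun _ => z0, fun _ => hX, tendsto_const_nhds, fun _ => hi⟩
      · exact hint z0 hX hfin hi
    have hval : Tendsto (fun k => h (F (xs k))) atTop (𝓝 (h (F z0))) :=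
      hcontrel _ _ (fun k => interior_subset (hxsint k)) hfin ((hF.continuous.tendsto z0).comp hxs)
    lift h (F z0) to ℝ using ⟨hfin, hbot _⟩ with a
    set ε : ℕ → ℝ := fun j => 1 / ((j : ℝ) + 1)
    have hεpos : ∀ j, 0 < ε j := fun j => Nat.one_div_pos_of_nat
    have hεlim : Tendsto ε atTop (𝓝 0) := tendsto_one_div_add_atTop_nhds_zero_nat
    obtain ⟨k, hk, hPk⟩ := exists_tendsto_atTop_eventually
      (P := fun j ν => ∃ x ∈ X, dist x z0 ≤ ε j ∧ hν ν (Fν ν x) ≤ (a + ε j : ℝ))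
      (fun j => by
        have hlt : (a : EReal) < (a + ε j : ℝ) := EReal.coe_lt_coe_iff.2 (by linarith [hεpos j])
        obtain ⟨l, hl, hld⟩ := ((hval.eventually_lt_const hlt).and
          (hxs.eventually (Metric.closedBall_mem_nhds _ (hεpos j)))).exists
        exact (hepi.eventually_le_of_continuousAt hνlsc hνcvx
          (continuousAt_of_seq_continuous_of_mem_interior hcontrel (hxsint l)) hl
          (hXF _ (hxsX l))).mono fun ν hle => ⟨xs l, hxsX l, hld, hle⟩)
    obtain ⟨x, hx⟩ : ∃ x : ℕ → Fin n → ℝ, ∀ᶠ ν in atTop, x ν ∈ X ∧ dist (x ν) z0 ≤ ε (k ν) ∧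
        hν ν (Fν ν (x ν)) ≤ (a + ε (k ν) : ℝ) := hPk.choice
    refine ⟨x, ?_, ?_⟩
    · rw [tendsto_iff_dist_tendsto_zero]
      exact squeeze_zero' (.of_forall fun _ => dist_nonneg) (hx.mono fun ν hν' => hν'.2.1)
        (hεlim.comp hk)
    · have hlim : Tendsto (fun ν => ((a + ε (k ν) : ℝ) : EReal)) atTop (𝓝 (a : EReal)) := by
        refine (continuous_coe_real_ereal.tendsto a).comp ?_
        simpa using (hεlim.comp hk).const_add a
      rw [← hlim.limsup_eq]
      refine limsup_le_limsup (hx.mono fun ν hν' => ?_)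
      simpa only [if_pos (hXsub ν hν'.1)] using hν'.2.2
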